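/- arXiv:0802.1607 — 2 statements merged into one kernel-verified Lean document; each statement's English description precedes it below -/
import Mathlib

section
/- Assume additionally that μ is not the zero measure, and for t > 0 and y ∈ ℝ set p_t(y) = (2π σ_t²)^{-1/2} exp(−y²/(2σ_t²)). Then for every 0 < t₀ ≤ t₁ < ∞ there exists a finite constant C = C(t₀, t₁, μ) such that for all t, t̄ ∈ [t₀, t₁] and all y ∈ ℝ, |p_t(y) − p_{t̄}(y)| ≤ C |t − t̄|. -/
open MeasureTheory Set Real
open scoped Classical

/-- `w s ξ = sin²(s‖ξ‖)/‖ξ‖²` for `ξ ≠ 0`, and `w s 0 = s²`. -/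
noncomputable def waveKernel (s : ℝ) (ξ : EuclideanSpace ℝ (Fin 3)) : ℝ :=
  if ξ = 0 then s ^ 2 else Real.sin (s * ‖ξ‖) ^ 2 / ‖ξ‖ ^ 2

/-- `σ_t² = ∫₀ᵗ ∫_{ℝ³} w(s,ξ) μ(dξ) ds`. -/
noncomputable def sigmaSq (μ : Measure (EuclideanSpace ℝ (Fin 3))) (t : ℝ) : ℝ :=
  ∫ s in (0 : ℝ)..t, ∫ ξ, waveKernel s ξ ∂μ

/-- `p_t(y)`: the density of the centered Gaussian law with variance `σ_t²`. -/
noncomputable def gaussDensity (μ : Measure (EuclideanSpace ℝ (Fin 3))) (t y : ℝ) : ℝ :=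
  Real.exp (-(y ^ 2) / (2 * sigmaSq μ t)) / Real.sqrt (2 * π * sigmaSq μ t)

lemma waveKernel_nonneg (s : ℝ) (ξ : EuclideanSpace ℝ (Fin 3)) : 0 ≤ waveKernel s ξ := by
  unfold waveKernel
  split_ifs <;> positivity

lemma waveKernel_le (s : ℝ) (ξ : EuclideanSpace ℝ (Fin 3)) :
    waveKernel s ξ ≤ (1 + s ^ 2) * (1 + ‖ξ‖ ^ 2)⁻¹ := by
  unfold waveKernel
  rw [← div_eq_mul_inv]
  split_ifs with h
  · simp [h]
  · have hξ : 0 < ‖ξ‖ := norm_pos_iff.mpr h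
    rw [div_le_div_iff₀ (by positivity) (by positivity)]
    have h1 : Real.sin (s * ‖ξ‖) ^ 2 ≤ 1 := Real.sin_sq_le_one _
    have h2 : Real.sin (s * ‖ξ‖) ^ 2 ≤ (s * ‖ξ‖) ^ 2 := sq_le_sq.mpr Real.abs_sin_le_abs
    nlinarith [mul_le_mul_of_nonneg_right h1 (sq_nonneg ‖ξ‖)]

lemma measurable_waveKernel (s : ℝ) : Measurable (waveKernel s) := by
  unfold waveKernel
  refine Measurable.ite (measurableSet_singleton 0) measurable_const ?_
  fun_prop

lemma continuous_waveKernel (ξ : EuclideanSpace ℝ (Fin 3)) :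
    Continuous fun s => waveKernel s ξ := by
  unfold waveKernel
  split_ifs <;> fun_prop

lemma integrable_waveKernel {μ : Measure (EuclideanSpace ℝ (Fin 3))}
    (hμ : Integrable (fun ξ : EuclideanSpace ℝ (Fin 3) => (1 + ‖ξ‖ ^ 2)⁻¹) μ) (s : ℝ) :
    Integrable (waveKernel s) μ := by
  refine (hμ.const_mul (1 + s ^ 2)).mono' (measurable_waveKernel s).aestronglyMeasurable
    (.of_forall fun ξ => ?_)
  rw [Real.norm_of_nonneg (waveKernel_nonneg s ξ)]
  exact waveKernel_le s ξ

lemma continuous_integral_waveKernel {μ : Measure (EuclideanSpace ℝ (Fin 3))}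
    (hμ : Integrable (fun ξ : EuclideanSpace ℝ (Fin 3) => (1 + ‖ξ‖ ^ 2)⁻¹) μ) :
    Continuous fun s => ∫ ξ, waveKernel s ξ ∂μ := by
  rw [continuous_iff_continuousAt]
  intro s
  refine continuousAt_of_dominated
    (bound := fun ξ => (1 + (|s| + 1) ^ 2) * (1 + ‖ξ‖ ^ 2)⁻¹)
    (.of_forall fun r => (measurable_waveKernel r).aestronglyMeasurable) ?_
    (hμ.const_mul _) (.of_forall fun ξ => (continuous_waveKernel ξ).continuousAt)
  have hs : ∀ᶠ r in nhds s, |r| < |s| + 1 :=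
    continuous_abs.continuousAt.eventually_lt_const (lt_add_one |s|)
  filter_upwards [hs] with r hr
  refine .of_forall fun ξ => ?_
  rw [Real.norm_of_nonneg (waveKernel_nonneg r ξ)]
  refine (waveKernel_le r ξ).trans ?_
  rw [← sq_abs r]
  gcongr

lemma integral_waveKernel_nonneg (μ : Measure (EuclideanSpace ℝ (Fin 3))) (s : ℝ) :
    0 ≤ ∫ ξ, waveKernel s ξ ∂μ :=
  integral_nonneg (waveKernel_nonneg s)

lemma waveKernel_pos {s : ℝ} (hs : 0 < s) {ξ : EuclideanSpace ℝ (Fin 3)} (h : s * ‖ξ‖ < π) :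
    0 < waveKernel s ξ := by
  unfold waveKernel
  split_ifs with hξ
  · positivity
  · have hn : 0 < ‖ξ‖ := norm_pos_iff.mpr hξ
    have := Real.sin_pos_of_pos_of_lt_pi (by positivity) h
    positivity

lemma exists_integral_waveKernel_pos {μ : Measure (EuclideanSpace ℝ (Fin 3))}
    (hμ : Integrable (fun ξ : EuclideanSpace ℝ (Fin 3) => (1 + ‖ξ‖ ^ 2)⁻¹) μ)
    (hne : μ ≠ 0) {t : ℝ} (ht : 0 < t) :
    ∃ s ∈ Icc 0 t, 0 < ∫ ξ, waveKernel s ξ ∂μ := by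
  by_contra! hcon
  have hmem (n : ℕ) : t / (n + 1) ∈ Icc 0 t :=
    ⟨by positivity, div_le_self ht.le (by linarith [n.cast_nonneg (α := ℝ)])⟩
  have hzero : ∀ᵐ ξ ∂μ, ∀ n : ℕ, waveKernel (t / (n + 1)) ξ = 0 := by
    rw [ae_all_iff]
    intro n
    exact (integral_eq_zero_iff_of_nonneg (waveKernel_nonneg _) (integrable_waveKernel hμ _)).mp
      (le_antisymm (hcon _ (hmem n)) (integral_waveKernel_nonneg μ _))
  have hfalse : ∀ᵐ _ξ ∂μ, False := by
    filter_upwards [hzero] with ξ hξ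
    obtain ⟨n, hn⟩ := exists_nat_gt (t * ‖ξ‖ / π)
    refine (waveKernel_pos (s := t / (n + 1)) (by positivity) ?_).ne' (hξ n)
    rw [div_lt_iff₀ Real.pi_pos] at hn
    rw [div_mul_eq_mul_div, div_lt_iff₀ (by positivity)]
    nlinarith [Real.pi_pos]
  exact hne (by simpa [Filter.eventually_false_iff_eq_bot] using hfalse)

lemma sigmaSq_pos {μ : Measure (EuclideanSpace ℝ (Fin 3))}
    (hμ : Integrable (fun ξ : EuclideanSpace ℝ (Fin 3) => (1 + ‖ξ‖ ^ 2)⁻¹) μ)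
    (hne : μ ≠ 0) {t : ℝ} (ht : 0 < t) : 0 < sigmaSq μ t :=
  intervalIntegral.integral_pos ht (continuous_integral_waveKernel hμ).continuousOn
    (fun s _ => integral_waveKernel_nonneg μ s) (exists_integral_waveKernel_pos hμ hne ht)

lemma sigmaSq_sub {μ : Measure (EuclideanSpace ℝ (Fin 3))}
    (hμ : Integrable (fun ξ : EuclideanSpace ℝ (Fin 3) => (1 + ‖ξ‖ ^ 2)⁻¹) μ) (s t : ℝ) :
    sigmaSq μ t - sigmaSq μ s = ∫ r in s..t, ∫ ξ, waveKernel r ξ ∂μ :=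
  intervalIntegral.integral_interval_sub_left
    ((continuous_integral_waveKernel hμ).intervalIntegrable _ _)
    ((continuous_integral_waveKernel hμ).intervalIntegrable _ _)

lemma sigmaSq_mono {μ : Measure (EuclideanSpace ℝ (Fin 3))}
    (hμ : Integrable (fun ξ : EuclideanSpace ℝ (Fin 3) => (1 + ‖ξ‖ ^ 2)⁻¹) μ) :
    Monotone (sigmaSq μ) := by
  intro s t hst
  rw [← sub_nonneg, sigmaSq_sub hμ]
  exact intervalIntegral.integral_nonneg hst fun r _ => integral_waveKernel_nonneg μ r

lemma abs_sigmaSq_sub_le {μ : Measure (EuclideanSpace ℝ (Fin 3))}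
    (hμ : Integrable (fun ξ : EuclideanSpace ℝ (Fin 3) => (1 + ‖ξ‖ ^ 2)⁻¹) μ) {T s t : ℝ}
    (hs : s ∈ Icc 0 T) (ht : t ∈ Icc 0 T) :
    |sigmaSq μ t - sigmaSq μ s| ≤ (1 + T ^ 2) * (∫ ξ, (1 + ‖ξ‖ ^ 2)⁻¹ ∂μ) * |t - s| := by
  rw [sigmaSq_sub hμ, ← Real.norm_eq_abs]
  refine intervalIntegral.norm_integral_le_of_norm_le_const fun r hr => ?_
  rw [Real.norm_of_nonneg (integral_waveKernel_nonneg μ r), ← integral_const_mul]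
  have hrT : r ∈ Icc 0 T := uIcc_subset_Icc hs ht (uIoc_subset_uIcc hr)
  refine integral_mono (integrable_waveKernel hμ r) (hμ.const_mul _) fun ξ => ?_
  refine (waveKernel_le r ξ).trans ?_
  have := hrT.1
  have := hrT.2
  gcongr

lemma hasDerivAt_gaussian_variance (y : ℝ) {v : ℝ} (hv : 0 < v) :
    HasDerivAt (fun v : ℝ => Real.exp (-(y ^ 2) / (2 * v)) / Real.sqrt (2 * π * v))
      (Real.exp (-(y ^ 2) / (2 * v)) * (y ^ 2 / (2 * v) - 1 / 2) / (v * Real.sqrt (2 * π * v)))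
      v := by
  have hpos : 0 < 2 * π * v := by positivity
  have h1 : HasDerivAt (fun v : ℝ => -(y ^ 2) / (2 * v))
      ((0 * (2 * v) - -(y ^ 2) * (2 * 1)) / (2 * v) ^ 2) v :=
    (hasDerivAt_const v _).div ((hasDerivAt_id v).const_mul 2) (by positivity)
  have h2 := ((hasDerivAt_id v).const_mul (2 * π)).sqrt hpos.ne'
  refine (h1.exp.div h2 (Real.sqrt_pos.mpr hpos).ne').congr_deriv ?_
  have hs : Real.sqrt (2 * π * v) ^ 2 = 2 * π * v := Real.sq_sqrt hpos.le
  have hs0 := (Real.sqrt_pos.mpr hpos).ne'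
  simp only [id]
  generalize Real.sqrt (2 * π * v) = q at *
  have hv0 := hv.ne'
  field_simp
  rw [hs]
  ring

lemma abs_gaussian_variance_sub_le (y : ℝ) {v₀ u v : ℝ} (h0 : 0 < v₀) (hu : v₀ ≤ u)
    (hv : v₀ ≤ v) :
    |Real.exp (-(y ^ 2) / (2 * v)) / Real.sqrt (2 * π * v)
      - Real.exp (-(y ^ 2) / (2 * u)) / Real.sqrt (2 * π * u)|
      ≤ 3 / 2 / (v₀ * Real.sqrt (2 * π * v₀)) * |v - u| := by
  refine (convex_Ici v₀).norm_image_sub_le_of_norm_hasDerivWithin_le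
    (fun x hx => (hasDerivAt_gaussian_variance y (h0.trans_le hx)).hasDerivWithinAt)
    (fun x hx => ?_) hu hv
  have hx : v₀ ≤ x := hx
  have hx0 : 0 < x := h0.trans_le hx
  have hden : 0 < x * Real.sqrt (2 * π * x) := by positivity
  rw [norm_div, Real.norm_of_nonneg hden.le, Real.norm_eq_abs]
  have hnum : |Real.exp (-(y ^ 2) / (2 * x)) * (y ^ 2 / (2 * x) - 1 / 2)| ≤ 3 / 2 := by
    rw [neg_div]
    have ha : 0 ≤ y ^ 2 / (2 * x) := by positivity
    generalize y ^ 2 / (2 * x) = a at *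
    have h1 : Real.exp (-a) * a ≤ 1 := by
      have := Real.add_one_le_exp a
      rw [Real.exp_neg, inv_mul_le_iff₀ (Real.exp_pos a)]
      linarith
    have h2 : Real.exp (-a) ≤ 1 := Real.exp_le_one_iff.mpr (by linarith)
    have h3 := Real.exp_pos (-a)
    rw [abs_le]
    constructor <;> nlinarith
  gcongr

theorem stmt5 (μ : Measure (EuclideanSpace ℝ (Fin 3)))
    (hμ : Integrable (fun ξ : EuclideanSpace ℝ (Fin 3) => (1 + ‖ξ‖ ^ 2)⁻¹) μ)
    (hne : μ ≠ 0) (t₀ t₁ : ℝ) (h0 : 0 < t₀) (h01 : t₀ ≤ t₁) :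
    ∃ C : ℝ, ∀ t tbar y : ℝ, t ∈ Icc t₀ t₁ → tbar ∈ Icc t₀ t₁ →
      |gaussDensity μ t y - gaussDensity μ tbar y| ≤ C * |t - tbar| := by
  have hpos := sigmaSq_pos hμ hne h0
  refine ⟨3 / 2 / (sigmaSq μ t₀ * Real.sqrt (2 * π * sigmaSq μ t₀)) *
    ((1 + t₁ ^ 2) * ∫ ξ, (1 + ‖ξ‖ ^ 2)⁻¹ ∂μ), fun t tbar y ht htbar => ?_⟩
  refine (abs_gaussian_variance_sub_le y hpos (sigmaSq_mono hμ htbar.1)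
    (sigmaSq_mono hμ ht.1)).trans ?_
  refine (mul_le_mul_of_nonneg_left (abs_sigmaSq_sub_le hμ ⟨h0.le.trans htbar.1, htbar.2⟩
    ⟨h0.le.trans ht.1, ht.2⟩) (by positivity)).trans_eq (mul_assoc _ _ _).symm
end

section
/- For every β ∈ (0,2) and every T > 0, ∫₀^T (1/r) (∫_{ℝ³} sin²(r‖ξ‖) ‖ξ‖^{β−5} dξ) dr < ∞. -/
open MeasureTheory Set
open scoped ENNReal

theorem integrableOn_sq_mul_sin_sq_mul_rpow {β : ℝ} (hβ : β ∈ Ioo (0 : ℝ) 2) :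
    IntegrableOn (fun y : ℝ ↦ y ^ 2 * (Real.sin y ^ 2 * y ^ (β - 5))) (Ioi 0) := by
  have hmeas (s : Set ℝ) : AEStronglyMeasurable
      (fun y : ℝ ↦ y ^ 2 * (Real.sin y ^ 2 * y ^ (β - 5))) (volume.restrict s) := by
    fun_prop
  rw [← Ioc_union_Ioi_eq_Ioi zero_le_one]
  refine IntegrableOn.union ?_ ?_
  · have h : IntegrableOn (fun y : ℝ ↦ y ^ (β - 1)) (Ioc 0 1) := by
      rw [← intervalIntegrable_iff_integrableOn_Ioc_of_le zero_le_one]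
      exact intervalIntegral.intervalIntegrable_rpow' (by linarith [hβ.1])
    refine Integrable.mono' h (hmeas _) ?_
    filter_upwards [ae_restrict_mem measurableSet_Ioc] with y hy
    have hy0 : 0 < y := hy.1
    rw [Real.norm_of_nonneg (by positivity)]
    calc y ^ 2 * (Real.sin y ^ 2 * y ^ (β - 5))
        ≤ y ^ 2 * (y ^ 2 * y ^ (β - 5)) := by
          gcongr ?_ * (?_ * ?_)
          exact sq_le_sq.mpr Real.abs_sin_le_abs
      _ = y ^ (β - 1) := by
          rw [← Real.rpow_natCast, ← Real.rpow_add hy0, ← Real.rpow_add hy0]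
          congr 1
          push_cast
          ring
  · refine Integrable.mono' (integrableOn_Ioi_rpow_of_lt (a := β - 3) (by linarith [hβ.2])
      zero_lt_one) (hmeas _) ?_
    filter_upwards [ae_restrict_mem measurableSet_Ioi] with y hy
    have hy0 : 0 < y := zero_lt_one.trans hy
    rw [Real.norm_of_nonneg (by positivity)]
    calc y ^ 2 * (Real.sin y ^ 2 * y ^ (β - 5))
        ≤ y ^ 2 * (1 * y ^ (β - 5)) := by
          gcongr
          exact Real.sin_sq_le_one y
      _ = y ^ (β - 3) := by
          rw [one_mul, ← Real.rpow_natCast, ← Real.rpow_add hy0]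
          congr 1
          push_cast
          ring

theorem integrable_sin_norm_sq_mul_norm_rpow {β : ℝ} (hβ : β ∈ Ioo (0 : ℝ) 2) :
    Integrable fun ξ : EuclideanSpace ℝ (Fin 3) ↦ Real.sin ‖ξ‖ ^ 2 * ‖ξ‖ ^ (β - 5) := by
  rw [integrable_fun_norm_addHaar volume (f := fun y ↦ Real.sin y ^ 2 * y ^ (β - 5))]
  simpa using integrableOn_sq_mul_sin_sq_mul_rpow hβ

theorem lintegral_sin_mul_norm_sq_mul_norm_rpow {β r : ℝ} (hβ : β ∈ Ioo (0 : ℝ) 2) (hr : 0 < r) :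
    ∫⁻ ξ : EuclideanSpace ℝ (Fin 3), ENNReal.ofReal (Real.sin (r * ‖ξ‖) ^ 2 * ‖ξ‖ ^ (β - 5)) =
      ENNReal.ofReal (r ^ (2 - β) *
        ∫ ξ : EuclideanSpace ℝ (Fin 3), Real.sin ‖ξ‖ ^ 2 * ‖ξ‖ ^ (β - 5)) := by
  set f : EuclideanSpace ℝ (Fin 3) → ℝ := fun ξ ↦ Real.sin ‖ξ‖ ^ 2 * ‖ξ‖ ^ (β - 5) with hf
  have hscale (ξ : EuclideanSpace ℝ (Fin 3)) :
      Real.sin (r * ‖ξ‖) ^ 2 * ‖ξ‖ ^ (β - 5) = r ^ (5 - β) * f (r • ξ) := by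
    have h : r ^ (5 - β) * r ^ (β - 5) = 1 := by
      rw [← Real.rpow_add hr]
      simp
    simp only [hf, norm_smul, Real.norm_of_nonneg hr.le, Real.mul_rpow hr.le (norm_nonneg ξ)]
    linear_combination (-Real.sin (r * ‖ξ‖) ^ 2 * ‖ξ‖ ^ (β - 5)) * h
  simp_rw [hscale]
  rw [← ofReal_integral_eq_lintegral_ofReal, integral_const_mul,
    Measure.integral_comp_smul_of_nonneg volume f r (hR := hr.le)]
  · congr 1
    rw [finrank_euclideanSpace_fin, smul_eq_mul, ← mul_assoc, ← Real.rpow_natCast,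
      ← Real.rpow_neg hr.le, ← Real.rpow_add hr]
    congr 2
    push_cast
    ring
  · exact ((integrable_sin_norm_sq_mul_norm_rpow hβ).comp_smul hr.ne').const_mul _
  · exact .of_forall fun ξ ↦ by simp only [hf, Pi.zero_apply]; positivity

theorem stmt8 (β T : ℝ) (hβ : β ∈ Ioo (0 : ℝ) 2) (hT : 0 < T) :
    (∫⁻ r in Ioc (0 : ℝ) T,
        (ENNReal.ofReal r)⁻¹ *
          ∫⁻ ξ : EuclideanSpace ℝ (Fin 3),
            ENNReal.ofReal (Real.sin (r * ‖ξ‖) ^ 2 * ‖ξ‖ ^ (β - 5))) < ⊤ := by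
  set C := ∫ ξ : EuclideanSpace ℝ (Fin 3), Real.sin ‖ξ‖ ^ 2 * ‖ξ‖ ^ (β - 5) with hC
  have hint : IntegrableOn (fun r : ℝ ↦ r ^ (1 - β) * C) (Ioc 0 T) := by
    rw [← intervalIntegrable_iff_integrableOn_Ioc_of_le hT.le]
    exact (intervalIntegral.intervalIntegrable_rpow' (by linarith [hβ.2])).mul_const C
  refine lt_of_eq_of_lt (setLIntegral_congr_fun measurableSet_Ioc fun r hr ↦ ?_)
    hint.lintegral_lt_top
  have hr0 : 0 < r := hr.1
  rw [lintegral_sin_mul_norm_sq_mul_norm_rpow hβ hr0, ← hC, ← ENNReal.ofReal_inv_of_pos hr0,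
    ← ENNReal.ofReal_mul (by positivity), ← mul_assoc, ← Real.rpow_neg_one,
    ← Real.rpow_add hr0]
  congr 3
  ring
end
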